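/- Let m be odd, a ∈ F_r^* with Tr(a^{-1}) = 0, and ρ ∈ F_p^*. Then the triple exponential sum Σ_{z ∈ F_p^*} Σ_{y ∈ F_p} Σ_{x ∈ F_r} ζ_p^{Tr(azx² + yx) − zρ} equals (-1)^{((p-1)/2)·((m-1)/2)} · η(a) · η̄(ρ) · p^{(m+3)/2} (as a complex number). -/

import Mathlib

/-- `ζ_p ^ c` for `c ∈ F_p`: `exp(2πi·c̃/p)` where `c̃` is the integer representative. -/
noncomputable def zetaP (p : ℕ) (c : ZMod p) : ℂ :=
  Complex.exp (2 * Real.pi * Complex.I * (c.val : ℂ) / (p : ℂ))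

section QuadraticGaussSum

open Finset

/-- The quadratic character of a finite field, with values in `ℂ`. -/
noncomputable def complexQuadraticChar (K : Type*) [Field K] [Fintype K] [DecidableEq K] : MulChar K ℂ :=
  (quadraticChar K).ringHomComp (Int.castRingHom ℂ)

section FiniteField

variable {K : Type*} [Field K] [Fintype K] [DecidableEq K]

lemma complexQuadraticChar_apply (t : K) :
    complexQuadraticChar K t = ((quadraticChar K t : ℤ) : ℂ) := rfl

lemma complexQuadraticChar_isQuadratic : (complexQuadraticChar K).IsQuadratic :=
  (quadraticChar_isQuadratic K).comp _

lemma complexQuadraticChar_ne_one (hK : ringChar K ≠ 2) : complexQuadraticChar K ≠ 1 :=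
  (MulChar.ringHomComp_ne_one_iff (Int.castRingHom ℂ).injective_int).mpr (quadraticChar_ne_one hK)

lemma complexQuadraticChar_mul_self {c : K} (hc : c ≠ 0) :
    complexQuadraticChar K c * complexQuadraticChar K c = 1 := by
  rw [complexQuadraticChar_apply, ← Int.cast_mul, ← sq, quadraticChar_sq_one hc, Int.cast_one]

/-- Twisting the quadratic Gauss sum by a nonzero scalar. -/
lemma sum_quadraticChar_mul_addChar (ψ : AddChar K ℂ) {c : K} (hc : c ≠ 0) :
    ∑ t, complexQuadraticChar K t * ψ (c * t) =
      complexQuadraticChar K c * gaussSum (complexQuadraticChar K) ψ := by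
  have h := gaussSum_mulShift (complexQuadraticChar K) ψ (Units.mk0 c hc)
  rw [← h, Units.val_mk0, ← mul_assoc, complexQuadraticChar_mul_self hc, one_mul]
  rfl

lemma sum_sq_eq_sum_one_add_quadraticChar (hK : ringChar K ≠ 2) (f : K → ℂ) :
    ∑ x, f (x ^ 2) = ∑ t, (1 + complexQuadraticChar K t) * f t := by
  rw [← Finset.sum_fiberwise' univ (fun x : K => x ^ 2) f]
  refine sum_congr rfl fun t _ => ?_
  rw [sum_const, nsmul_eq_mul]
  congr 1
  have h := quadraticChar_card_sqrts hK t
  rw [complexQuadraticChar_apply, add_comm]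
  rw [show ({x | x ^ 2 = t} : Finset K) = {x : K | x ^ 2 = t}.toFinset by ext; simp]
  exact_mod_cast h

/-- A quadratic exponential sum in one variable is a twisted Gauss sum. -/
lemma sum_addChar_mul_sq (hK : ringChar K ≠ 2) {ψ : AddChar K ℂ} (hψ : ψ.IsPrimitive)
    {c : K} (hc : c ≠ 0) :
    ∑ x, ψ (c * x ^ 2) = complexQuadraticChar K c * gaussSum (complexQuadraticChar K) ψ := by
  have h0 : ∑ t, ψ (c * t) = 0 := AddChar.sum_eq_zero_of_ne_one (hψ hc)
  rw [sum_sq_eq_sum_one_add_quadraticChar hK (fun t => ψ (c * t))]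
  simp only [add_mul, one_mul, sum_add_distrib]
  rw [h0, zero_add, sum_quadraticChar_mul_addChar ψ hc]

end FiniteField

section Extension

variable {k F : Type*} [Field k] [Field F] [Fintype F] [Algebra k F]

/-- The discriminant of any basis of a finite extension of finite fields is a square upstairs. -/
lemma isSquare_algebraMap_discr {ι : Type*} [Fintype ι] [DecidableEq ι] (b : Module.Basis ι k F) :
    IsSquare (algebraMap k F (Algebra.discr k b)) := by
  classical
  have hcard : Fintype.card Gal(F/k) = Fintype.card ι := by
    rw [← Nat.card_eq_fintype_card, IsGalois.card_aut_eq_finrank, Module.finrank_eq_card_basis b]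
  let e := Fintype.equivOfCardEq hcard
  let M : Matrix ι ι F := Matrix.of fun i j => e.symm i (b j)
  have hM : (Algebra.traceMatrix k b).map (algebraMap k F) = M.transpose * M := by
    ext i j
    simp only [Matrix.map_apply, Algebra.traceMatrix_apply, Algebra.traceForm_apply,
      trace_eq_sum_automorphisms, Matrix.mul_apply, Matrix.transpose_apply, M, Matrix.of_apply,
      map_mul]
    exact (Equiv.sum_comp e.symm fun σ : Gal(F/k) => σ (b i) * σ (b j)).symm
  refine ⟨M.det, ?_⟩
  rw [Algebra.discr_def, RingHom.map_det, RingHom.mapMatrix_apply, hM, Matrix.det_mul,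
    Matrix.det_transpose]

variable [Fintype k]

/-- In an extension of odd degree, the quadratic character restricts to that of the base. -/
lemma quadraticChar_algebraMap_of_odd [DecidableEq k] [DecidableEq F]
    (hodd : Odd (Module.finrank k F)) (z : k) :
    quadraticChar F (algebraMap k F z) = quadraticChar k z := by
  rcases eq_or_ne z 0 with rfl | hz
  · simp
  have hz' : algebraMap k F z ≠ 0 := by simpa using hz
  have hsq : IsSquare (algebraMap k F z) ↔ IsSquare z := by
    refine ⟨fun h => ?_, fun h => h.map _⟩
    have h' := h.map (Algebra.norm k)
    rw [Algebra.norm_algebraMap, ← quadraticChar_one_iff_isSquare (pow_ne_zero _ hz), map_pow] at h'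
    rw [← quadraticChar_one_iff_isSquare hz]
    rcases quadraticChar_dichotomy hz with h1 | h1
    · exact h1
    · rw [h1, hodd.neg_one_pow] at h'
      norm_num at h'
  by_cases h : IsSquare z
  · rw [(quadraticChar_one_iff_isSquare hz).mpr h,
      (quadraticChar_one_iff_isSquare hz').mpr (hsq.mpr h)]
  · rw [quadraticChar_neg_one_iff_not_isSquare.mpr h,
      quadraticChar_neg_one_iff_not_isSquare.mpr (mt hsq.mp h)]

/-- The Hasse–Davenport relation for quadratic Gauss sums in odd degree. -/
theorem sum_addChar_trace_sq_of_odd [DecidableEq k] [DecidableEq F]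
    (hk : ringChar k ≠ 2) (hodd : Odd (Module.finrank k F)) {ψ : AddChar k ℂ}
    (hψ : ψ.IsPrimitive) :
    ∑ x : F, ψ (Algebra.trace k F (x ^ 2)) =
      gaussSum (complexQuadraticChar k) ψ ^ Module.finrank k F := by
  have : Invertible (2 : k) := invertibleOfNonzero (Ring.two_ne_zero hk)
  obtain ⟨b, hb⟩ := LinearMap.BilinForm.exists_orthogonal_basis (B := Algebra.traceForm k F)
    ⟨fun x y => by simp [Algebra.traceForm_apply, mul_comm]⟩
  set d := fun i => Algebra.trace k F (b i * b i)
  have hoff : ∀ i j, i ≠ j → Algebra.trace k F (b i * b j) = 0 := fun i j hij => hb hij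
  have hdisc : Algebra.discr k b = ∏ i, d i := by
    rw [Algebra.discr_def, ← Matrix.det_diagonal]
    congr 1
    ext i j
    rcases eq_or_ne i j with rfl | hij
    · simp [d, Algebra.traceMatrix_apply]
    · simp [Matrix.diagonal_apply_ne _ hij, Algebra.traceMatrix_apply, hoff i j hij]
  have hne : Algebra.discr k b ≠ 0 := Algebra.discr_not_zero_of_basis k b
  have hd : ∀ i, d i ≠ 0 := fun i => Finset.prod_ne_zero_iff.mp (hdisc ▸ hne) i (mem_univ i)
  have hχ : ∏ i, complexQuadraticChar k (d i) = 1 := by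
    rw [← map_prod, ← hdisc, complexQuadraticChar_apply, ← quadraticChar_algebraMap_of_odd (F := F) hodd,
      (quadraticChar_one_iff_isSquare _).mpr (isSquare_algebraMap_discr b), Int.cast_one]
    simpa using hne
  have htr (v : Fin (Module.finrank k F) → k) :
      Algebra.trace k F ((b.equivFun.symm v) ^ 2) = ∑ i, d i * v i ^ 2 := by
    rw [Module.Basis.equivFun_symm_apply, sq, sum_mul_sum, map_sum]
    refine sum_congr rfl fun i _ => ?_
    rw [map_sum, sum_eq_single i]
    · rw [smul_mul_smul_comm, map_smul, smul_eq_mul]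
      simp only [d]; ring
    · intro j _ hj
      rw [smul_mul_smul_comm, map_smul, hoff i j hj.symm, smul_zero]
    · simp
  rw [← Equiv.sum_comp b.equivFun.symm.toEquiv]
  have hmul (v : Fin (Module.finrank k F) → k) :
      ψ (∑ i, d i * v i ^ 2) = ∏ i, ψ (d i * v i ^ 2) :=
    (map_sum ψ.toAddMonoidHom (fun i => d i * v i ^ 2) univ :)
  simp only [LinearEquiv.coe_toEquiv, htr, hmul]
  rw [← Fintype.piFinset_univ, ← Finset.prod_univ_sum (fun _ => univ) fun i t => ψ (d i * t ^ 2)]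
  simp only [sum_addChar_mul_sq hk hψ (hd _), prod_mul_distrib, hχ, one_mul, prod_const,
    card_univ, Fintype.card_fin]

/-- The pullback of a nontrivial additive character along the trace is primitive. -/
lemma isPrimitive_compAddMonoidHom_trace {ψ : AddChar k ℂ} (hψ : ψ.IsPrimitive) :
    (ψ.compAddMonoidHom (Algebra.trace k F).toAddMonoidHom).IsPrimitive := by
  refine AddChar.IsPrimitive.of_ne_one ?_
  obtain ⟨c, hc⟩ := AddChar.ne_one_iff.mp (hψ one_ne_zero)
  obtain ⟨x, hx⟩ := Algebra.trace_surjective k F c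
  refine AddChar.ne_one_iff.mpr ⟨x, ?_⟩
  simpa [AddChar.mulShift_apply, hx] using hc

/-- The inner exponential sum does not depend on the linear coefficient when `a⁻¹` has trace zero. -/
lemma sum_addChar_trace_quadratic [DecidableEq k] [DecidableEq F]
    (hk : ringChar k ≠ 2) (hodd : Odd (Module.finrank k F)) {ψ : AddChar k ℂ}
    (hψ : ψ.IsPrimitive) {a : F} (ha : a ≠ 0) (hTr : Algebra.trace k F a⁻¹ = 0)
    {z : k} (hz : z ≠ 0) (y : k) :
    ∑ x : F, ψ (Algebra.trace k F (a * algebraMap k F z * x ^ 2 + algebraMap k F y * x)) =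
      complexQuadraticChar F a * complexQuadraticChar k z *
        gaussSum (complexQuadraticChar k) ψ ^ Module.finrank k F := by
  have hF : ringChar F ≠ 2 := by rwa [← Algebra.ringChar_eq k F]
  have h2 : (2 : F) ≠ 0 := Ring.two_ne_zero hF
  have hz' : algebraMap k F z ≠ 0 := by simpa using hz
  have hcomplete (x : F) :
      Algebra.trace k F (a * algebraMap k F z * x ^ 2 + algebraMap k F y * x) =
        Algebra.trace k F
          (a * algebraMap k F z * (x + algebraMap k F y / (2 * a * algebraMap k F z)) ^ 2) := by
    have hsplit : a * algebraMap k F z * (x + algebraMap k F y / (2 * a * algebraMap k F z)) ^ 2 =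
        a * algebraMap k F z * x ^ 2 + algebraMap k F y * x + (y ^ 2 / (4 * z)) • a⁻¹ := by
      have h4 : (4 : F) ≠ 0 := by
        rw [show (4 : F) = 2 * 2 by norm_num]; exact mul_ne_zero h2 h2
      rw [Algebra.smul_def]
      simp only [map_div₀, map_mul, map_pow, map_ofNat]
      field_simp
      ring
    rw [hsplit, map_add _ (_ + _), map_smul, hTr, smul_zero, add_zero]
  set Ψ := ψ.compAddMonoidHom (Algebra.trace k F).toAddMonoidHom
  have hΨ : Ψ.IsPrimitive := isPrimitive_compAddMonoidHom_trace hψ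
  have hΨ_apply (x : F) : ψ (Algebra.trace k F x) = Ψ x := rfl
  have hG : gaussSum (complexQuadraticChar F) Ψ =
      gaussSum (complexQuadraticChar k) ψ ^ Module.finrank k F := by
    rw [← sum_addChar_trace_sq_of_odd hk hodd hψ]
    simpa [hΨ_apply] using (sum_addChar_mul_sq hF hΨ one_ne_zero).symm
  simp only [hcomplete]
  rw [Fintype.sum_equiv (Equiv.addRight (algebraMap k F y / (2 * a * algebraMap k F z))) _
    (fun x => ψ (Algebra.trace k F (a * algebraMap k F z * x ^ 2)))
    fun x => by rw [Equiv.coe_addRight]]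
  simp only [hΨ_apply]
  rw [sum_addChar_mul_sq hF hΨ (mul_ne_zero ha hz'), hG, map_mul,
    complexQuadraticChar_apply (algebraMap k F z), quadraticChar_algebraMap_of_odd hodd,
    ← complexQuadraticChar_apply]

end Extension

lemma zetaP_eq_stdAddChar (p : ℕ) [NeZero p] (c : ZMod p) : zetaP p c = ZMod.stdAddChar c := by
  have h := ZMod.stdAddChar_coe (N := p) (c.val : ℤ)
  rw [Int.cast_natCast, ZMod.natCast_zmod_val] at h
  rw [h, zetaP, Int.cast_natCast]

lemma complexQuadraticChar_neg_one (p : ℕ) [Fact p.Prime] (hp : p ≠ 2) :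
    complexQuadraticChar (ZMod p) (-1) = (-1) ^ ((p - 1) / 2) := by
  have hodd : p % 2 = 1 := Nat.odd_iff.mp ((Fact.out : p.Prime).odd_of_ne_two hp)
  rw [complexQuadraticChar_apply, quadraticChar_neg_one (by rwa [ZMod.ringChar_zmod_n]),
    ZMod.card, ZMod.χ₄_eq_neg_one_pow hodd, show p / 2 = (p - 1) / 2 by omega]
  push_cast
  rfl

end QuadraticGaussSum

theorem stmt_6 (p m : ℕ) [Fact p.Prime] (hp2 : p ≠ 2) (hm : 2 ≤ m) (hmodd : Odd m)
    (F : Type) [Field F] [Fintype F] [DecidableEq F] [Algebra (ZMod p) F]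
    (hcard : Fintype.card F = p ^ m)
    (a : F) (ha : a ≠ 0) (hTra : Algebra.trace (ZMod p) F a⁻¹ = 0)
    (ρ : ZMod p) (hρ : ρ ≠ 0) :
    (∑ z ∈ Finset.univ.filter (fun z : ZMod p => z ≠ 0), ∑ y : ZMod p, ∑ x : F,
        zetaP p (Algebra.trace (ZMod p) F
          (a * algebraMap (ZMod p) F z * x ^ 2 + algebraMap (ZMod p) F y * x) - z * ρ))
      = (((-1) ^ (((p - 1) / 2) * ((m - 1) / 2)) * quadraticChar F a
          * quadraticChar (ZMod p) ρ * (p : ℤ) ^ ((m + 3) / 2) : ℤ) : ℂ) := by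
  classical
  have hcardF : Module.finrank (ZMod p) F = m := by
    have h := Module.card_eq_pow_finrank (K := ZMod p) (V := F)
    rw [hcard, ZMod.card] at h
    exact (Nat.pow_right_injective (Fact.out : p.Prime).two_le h).symm
  have hk : ringChar (ZMod p) ≠ 2 := by rwa [ZMod.ringChar_zmod_n]
  have hψ : (ZMod.stdAddChar (N := p)).IsPrimitive := ZMod.isPrimitive_stdAddChar p
  set ψ := ZMod.stdAddChar (N := p)
  set g := gaussSum (complexQuadraticChar (ZMod p)) ψ
  have hinner : ∀ z ∈ Finset.univ.filter (fun z : ZMod p => z ≠ 0),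
      (∑ y : ZMod p, ∑ x : F,
        zetaP p (Algebra.trace (ZMod p) F
          (a * algebraMap (ZMod p) F z * x ^ 2 + algebraMap (ZMod p) F y * x) - z * ρ)) =
      p * complexQuadraticChar F a * g ^ m *
        (complexQuadraticChar (ZMod p) z * ψ (-ρ * z)) := by
    intro z hz
    have hz0 : z ≠ 0 := (Finset.mem_filter.mp hz).2
    have hterm (y : ZMod p) : (∑ x : F, zetaP p (Algebra.trace (ZMod p) F
          (a * algebraMap (ZMod p) F z * x ^ 2 + algebraMap (ZMod p) F y * x) - z * ρ)) =
        complexQuadraticChar F a * complexQuadraticChar (ZMod p) z * g ^ m * ψ (-ρ * z) := by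
      have h := sum_addChar_trace_quadratic hk (hcardF ▸ hmodd) hψ ha hTra hz0 y
      rw [hcardF] at h
      rw [← h, Finset.sum_mul]
      refine Finset.sum_congr rfl fun x _ => ?_
      rw [zetaP_eq_stdAddChar, ← AddChar.map_add_eq_mul]
      congr 1
      ring
    simp only [hterm, Finset.sum_const, Finset.card_univ, ZMod.card, nsmul_eq_mul]
    ring
  rw [Finset.sum_congr rfl hinner, ← Finset.mul_sum, Finset.sum_filter_of_ne,
    sum_quadraticChar_mul_addChar ψ (neg_ne_zero.mpr hρ)]
  swap
  · rintro z - h rfl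
    simp [MulChar.map_zero] at h
  obtain ⟨j, rfl⟩ := hmodd
  have hg : g ^ 2 = complexQuadraticChar (ZMod p) (-1) * p := by
    simpa using gaussSum_sq (complexQuadraticChar_ne_one hk) complexQuadraticChar_isQuadratic hψ
  have hε := complexQuadraticChar_mul_self (K := ZMod p) (neg_ne_zero.mpr one_ne_zero)
  rw [show (2 * j + 1 - 1) / 2 = j by omega, show (2 * j + 1 + 3) / 2 = j + 2 by omega, pow_mul]
  push_cast
  rw [← complexQuadraticChar_neg_one p hp2, ← complexQuadraticChar_apply,
    ← complexQuadraticChar_apply, neg_eq_neg_one_mul ρ, map_mul]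
  set ε := complexQuadraticChar (ZMod p) (-1)
  calc
    _ = p * complexQuadraticChar F a * ε * complexQuadraticChar (ZMod p) ρ * (g ^ 2) ^ (j + 1) := by
      ring
    _ = (ε * ε) * (ε ^ j * complexQuadraticChar F a * complexQuadraticChar (ZMod p) ρ *
          (p : ℂ) ^ (j + 2)) := by
      rw [hg]; ring
    _ = _ := by rw [hε, one_mul]
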